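/- For all integers m ≥ 1, a ≥ 0, ρ ≥ 1 and every positive integer n, the determinant of the n×n matrix whose (i,j)-entry (0 ≤ i,j ≤ n−1) is binom(mi+j+a+2ρ, mi+a+2ρ) + binom(mi−j+a, mi+a+2ρ) equals one half of the determinant of the n×n matrix whose (i,j)-entry is binom(mi+j+a, mi+a) + binom(mi−j+a, mi+a). -/

import Mathlib

open scoped BigOperators

/-- Generalized binomial coefficient: `binom α p = α(α−1)⋯(α−p+1)/p!`. -/
def binom (α : ℤ) (p : ℕ) : ℚ :=
  (∏ k ∈ Finset.range p, ((α : ℚ) - (k : ℚ))) / (p.factorial : ℚ)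

theorem binom_zero_right (α : ℤ) : binom α 0 = 1 := by simp [binom]

/-- Pascal's rule. -/
theorem binom_succ_succ (α : ℤ) (p : ℕ) :
    binom (α + 1) (p + 1) = binom α (p + 1) + binom α p := by
  have h : ∏ k ∈ Finset.range p, (((α + 1 : ℤ) : ℚ) - ((k + 1 : ℕ) : ℚ)) =
      ∏ k ∈ Finset.range p, ((α : ℚ) - (k : ℚ)) :=
    Finset.prod_congr rfl fun k _ => by push_cast; ring
  unfold binom
  rw [Finset.prod_range_succ', h, Finset.prod_range_succ, Nat.factorial_succ]
  have h1 : (p.factorial : ℚ) ≠ 0 := by exact_mod_cast p.factorial_ne_zero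
  have h2 : (p : ℚ) + 1 ≠ 0 := by positivity
  push_cast
  field_simp
  ring

theorem binom_eq_zero {α : ℤ} {p : ℕ} (h0 : 0 ≤ α) (h : α < p) : binom α p = 0 := by
  lift α to ℕ using h0
  have : ∏ k ∈ Finset.range p, (((α : ℤ) : ℚ) - (k : ℚ)) = 0 :=
    Finset.prod_eq_zero (Finset.mem_range.2 (by exact_mod_cast h)) (by simp)
  rw [binom, this, zero_div]

/-- `binom` extended by zero to negative lower indices. -/
def intBinom (α r : ℤ) : ℚ := if r < 0 then 0 else binom α r.toNat

theorem intBinom_natCast (α : ℤ) (p : ℕ) : intBinom α p = binom α p := by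
  simp [intBinom]

theorem intBinom_of_neg (α : ℤ) {r : ℤ} (hr : r < 0) : intBinom α r = 0 := if_pos hr

theorem intBinom_pascal (α r : ℤ) :
    intBinom (α + 1) r = intBinom α r + intBinom α (r - 1) := by
  rcases lt_or_ge r 0 with hr | hr
  · simp [intBinom_of_neg, hr, show r - 1 < 0 by omega]
  lift r to ℕ using hr
  cases r with
  | zero =>
    rw [intBinom_natCast, intBinom_natCast, intBinom_of_neg _ (by simp)]
    simp [binom_zero_right]
  | succ p =>
    rw [show ((p + 1 : ℕ) : ℤ) - 1 = (p : ℤ) by push_cast; ring]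
    simp only [intBinom_natCast, binom_succ_succ]

/-- The second difference of `intBinom` in its upper index. -/
theorem intBinom_second_diff (α r : ℤ) :
    intBinom (α + 1) r = 2 * intBinom α r - intBinom (α - 1) r + intBinom (α - 1) (r - 2) := by
  have h1 := intBinom_pascal α r
  have h2 := intBinom_pascal (α - 1) r
  have h3 := intBinom_pascal (α - 1) (r - 1)
  rw [sub_add_cancel] at h2 h3
  rw [show r - 1 - 1 = r - 2 by ring] at h3
  linarith

/-- Coefficients of `y ^ s + y⁻¹ ^ s` as a polynomial in `y + y⁻¹ - 2`. -/
def lucasCoeff : ℕ → ℕ → ℚ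
  | 0, 0 => 2
  | 0, _ + 1 => 0
  | 1, 0 => 2
  | 1, 1 => 1
  | 1, _ + 2 => 0
  | s + 2, 0 => 2 * lucasCoeff (s + 1) 0 - lucasCoeff s 0
  | s + 2, k + 1 =>
    2 * lucasCoeff (s + 1) (k + 1) - lucasCoeff s (k + 1) + lucasCoeff (s + 1) k

theorem lucasCoeff_eq_zero (s k : ℕ) (h : s < k) : lucasCoeff s k = 0 := by
  induction s using Nat.twoStepInduction generalizing k with
  | zero => obtain ⟨k, rfl⟩ := Nat.exists_eq_add_of_lt h; simp [lucasCoeff]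
  | one =>
    obtain ⟨k, rfl⟩ := Nat.exists_eq_add_of_le h
    rw [show 1 + 1 + k = k + 2 by ring, lucasCoeff]
  | more s ih1 ih2 =>
    obtain ⟨k, rfl⟩ : ∃ l, k = l + 1 := ⟨k - 1, by omega⟩
    rw [lucasCoeff, ih1 _ (by omega), ih2 _ (by omega), ih2 _ (by omega)]
    ring

theorem lucasCoeff_succ_self (s : ℕ) : lucasCoeff (s + 1) (s + 1) = 1 := by
  induction s with
  | zero => simp [lucasCoeff]
  | succ s ih =>
    rw [lucasCoeff, ih, lucasCoeff_eq_zero _ _ (by omega), lucasCoeff_eq_zero _ _ (by omega)]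
    ring

theorem intBinom_add_intBinom (s N : ℕ) (h : s < N) (q r : ℤ) :
    intBinom (q + s) r + intBinom (q - s) r =
      ∑ k ∈ Finset.range N, lucasCoeff s k * intBinom (q - k) (r - 2 * k) := by
  induction s using Nat.twoStepInduction generalizing N q r with
  | zero =>
    obtain ⟨N, rfl⟩ : ∃ l, N = l + 1 := ⟨N - 1, by omega⟩
    rw [Finset.sum_range_succ']
    simp [lucasCoeff]
    ring
  | one =>
    obtain ⟨N, rfl⟩ : ∃ l, N = l + 2 := ⟨N - 2, by omega⟩
    rw [Finset.sum_range_succ', Finset.sum_range_succ']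
    have := intBinom_second_diff q r
    simp [lucasCoeff]
    linarith
  | more s ih1 ih2 =>
    obtain ⟨N, rfl⟩ : ∃ l, N = l + 1 := ⟨N - 1, by omega⟩
    have e1 := ih1 (N + 1) (by omega) q r
    have e2 := ih2 (N + 1) (by omega) q r
    have e3 := ih2 N (by omega) (q - 1) (r - 2)
    have d1 := intBinom_second_diff (q + (s + 1)) r
    have d2 := intBinom_second_diff (q - (s + 1)) r
    rw [Finset.sum_range_succ'] at e1 e2 ⊢
    have key : ∑ k ∈ Finset.range N,
          lucasCoeff (s + 2) (k + 1) * intBinom (q - (k + 1 : ℕ)) (r - 2 * (k + 1 : ℕ)) =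
        2 * ∑ k ∈ Finset.range N,
          lucasCoeff (s + 1) (k + 1) * intBinom (q - (k + 1 : ℕ)) (r - 2 * (k + 1 : ℕ))
        - ∑ k ∈ Finset.range N,
          lucasCoeff s (k + 1) * intBinom (q - (k + 1 : ℕ)) (r - 2 * (k + 1 : ℕ))
        + ∑ k ∈ Finset.range N, lucasCoeff (s + 1) k * intBinom (q - 1 - k) (r - 2 - 2 * k) := by
      rw [Finset.mul_sum, ← Finset.sum_sub_distrib, ← Finset.sum_add_distrib]
      refine Finset.sum_congr rfl fun k _ => ?_
      rw [lucasCoeff, show q - 1 - (k : ℤ) = q - (k + 1 : ℕ) by push_cast; ring,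
        show r - 2 - 2 * (k : ℤ) = r - 2 * (k + 1 : ℕ) by push_cast; ring]
      ring
    rw [key, lucasCoeff, ← e3]
    push_cast at e1 e2 ⊢
    rw [show q + ((s : ℤ) + 2) = q + (s + 1) + 1 by ring, d1]
    rw [show q - ((s : ℤ) + 1) + 1 = q - s by ring] at d2
    rw [show q + ((s : ℤ) + 1) - 1 = q + s by ring,
      show q - 1 + ((s : ℤ) + 1) = q + s by ring,
      show q - 1 - ((s : ℤ) + 1) = q - (s + 2) by ring]
    rw [show q - ((s : ℤ) + 1) - 1 = q - (s + 2) by ring] at d2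
    linarith

theorem binom_add_binom (p ρ n j : ℕ) (hj : j < n) :
    binom (((p + 2 * ρ : ℕ) : ℤ) + (j : ℤ)) (p + 2 * ρ) + binom ((p : ℤ) - (j : ℤ)) (p + 2 * ρ) =
      ∑ l : Fin n, intBinom ((p : ℤ) - (l : ℕ)) ((p : ℤ) - 2 * (l : ℕ)) *
        lucasCoeff (ρ + j) (ρ + l) := by
  have h := intBinom_add_intBinom (ρ + j) (ρ + n) (by omega) (p + ρ) ((p + 2 * ρ : ℕ) : ℤ)
  rw [Finset.sum_range_add, Finset.sum_eq_zero, zero_add] at h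
  · rw [← intBinom_natCast, ← intBinom_natCast,
      Fin.sum_univ_eq_sum_range (fun l => intBinom ((p : ℤ) - (l : ℕ)) ((p : ℤ) - 2 * (l : ℕ)) *
        lucasCoeff (ρ + j) (ρ + l))]
    convert h using 1
    · congr 2 <;> push_cast <;> ring
    · refine Finset.sum_congr rfl fun l _ => ?_
      rw [mul_comm]
      congr 2 <;> push_cast <;> ring
  · intro k hk
    rw [Finset.mem_range] at hk
    rw [show ((p + 2 * ρ : ℕ) : ℤ) - 2 * k = ((p + 2 * ρ - 2 * k : ℕ) : ℤ) by omega,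
      intBinom_natCast, binom_eq_zero (by omega) (by omega), mul_zero]

theorem det_binom_add_binom (n ρ : ℕ) (p : Fin n → ℕ) :
    (Matrix.of fun i j : Fin n =>
        binom (((p i + 2 * ρ : ℕ) : ℤ) + ((j : ℕ) : ℤ)) (p i + 2 * ρ)
          + binom ((p i : ℤ) - ((j : ℕ) : ℤ)) (p i + 2 * ρ)).det =
      (Matrix.of fun i l : Fin n =>
        intBinom ((p i : ℤ) - (l : ℕ)) ((p i : ℤ) - 2 * (l : ℕ))).det *
      ∏ j : Fin n, lucasCoeff (ρ + j) (ρ + j) := by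
  have hT : (Matrix.of fun l j : Fin n => lucasCoeff (ρ + j) (ρ + l)).BlockTriangular id :=
    fun l j hlj => lucasCoeff_eq_zero _ _ (Nat.add_lt_add_left (Fin.lt_def.1 hlj) ρ)
  have hdet := Matrix.det_of_isUpperTriangular hT
  simp only [Matrix.of_apply] at hdet
  rw [← hdet, ← Matrix.det_mul]
  congr 1
  ext i j
  rw [Matrix.mul_apply]
  exact binom_add_binom (p i) ρ n j j.2

theorem stmt_15 (m a ρ : ℕ) (hm : 1 ≤ m) (hρ : 1 ≤ ρ) (n : ℕ) (hn : 0 < n) :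
    (Matrix.of fun i j : Fin n =>
        binom (((m * (i : ℕ) + a + 2 * ρ : ℕ) : ℤ) + ((j : ℕ) : ℤ)) (m * (i : ℕ) + a + 2 * ρ)
          + binom (((m * (i : ℕ) + a : ℕ) : ℤ) - ((j : ℕ) : ℤ)) (m * (i : ℕ) + a + 2 * ρ)).det =
      (1 / 2) * (Matrix.of fun i j : Fin n =>
        binom (((m * (i : ℕ) + a : ℕ) : ℤ) + ((j : ℕ) : ℤ)) (m * (i : ℕ) + a)
          + binom (((m * (i : ℕ) + a : ℕ) : ℤ) - ((j : ℕ) : ℤ)) (m * (i : ℕ) + a)).det := by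
  have hA := det_binom_add_binom n ρ fun i => m * (i : ℕ) + a
  have hB := det_binom_add_binom n 0 fun i => m * (i : ℕ) + a
  have h1 : ∏ j : Fin n, lucasCoeff (ρ + j) (ρ + j) = 1 := by
    refine Finset.prod_eq_one fun j _ => ?_
    rw [show ρ + (j : ℕ) = ρ + j - 1 + 1 by omega]
    exact lucasCoeff_succ_self _
  have h2 : ∏ j : Fin n, lucasCoeff (0 + j) (0 + j) = 2 := by
    obtain ⟨n, rfl⟩ : ∃ k, n = k + 1 := ⟨n - 1, by omega⟩
    rw [Fin.prod_univ_succ, Finset.prod_eq_one fun j _ => ?_]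
    · simp [lucasCoeff]
    · simpa using lucasCoeff_succ_self (j : ℕ)
  rw [h1] at hA
  rw [h2] at hB
  simp only [mul_zero, add_zero] at hB
  rw [hA, hB]
  ring
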